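/- Let G be a group and let σ : G × G → 𝕋 be a 2-cocycle. If γ ∈ G is central (γy = yγ for all y ∈ G), then the map ω_γ : G → 𝕋 defined by ω_γ(y) = conj(σ(γ, y)) · σ(y, γ) is a group homomorphism, i.e. ω_γ(yy') = ω_γ(y) ω_γ(y') for all y, y' ∈ G. -/

import Mathlib

/-- For a `2`-cocycle `σ : G × G → 𝕋` and a central element `γ`, the map
`ω_γ(y) = conj (σ(γ,y)) ⬝ σ(y,γ)` is a group homomorphism. -/
theorem stmt12
    {G : Type*} [Group G]
    (σ : G → G → ℂ)
    (hσ_mod : ∀ x y : G, ‖σ x y‖ = 1)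
    (hσ_e : σ 1 1 = 1)
    (hσ_cocycle : ∀ x y z : G, σ x y * σ (x * y) z = σ x (y * z) * σ y z)
    (γ : G) (hγ : ∀ y : G, γ * y = y * γ) :
    ∀ y y' : G,
      (starRingEnd ℂ) (σ γ (y * y')) * σ (y * y') γ
        = ((starRingEnd ℂ) (σ γ y) * σ y γ) * ((starRingEnd ℂ) (σ γ y') * σ y' γ) := by
  intro y y'
  have h_ne (a b : G) : σ a b ≠ 0 := norm_ne_zero_iff.mp (by simp [hσ_mod])
  have h_conj (a b : G) : (starRingEnd ℂ) (σ a b) = (σ a b)⁻¹ :=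
    (Complex.inv_eq_conj (hσ_mod a b)).symm
  have h₁ := hσ_cocycle γ y y'
  have h₂ := hσ_cocycle y γ y'
  have h₃ := hσ_cocycle y y' γ
  rw [← hγ y] at h₂
  rw [← hγ y'] at h₃
  have key : σ (y * y') γ * (σ γ y * σ γ y') = σ y γ * σ y' γ * σ γ (y * y') := by
    apply mul_left_cancel₀ (h_ne y y')
    linear_combination (σ γ y * σ γ y') * h₃ - (σ γ y * σ y' γ) * h₂ + (σ y γ * σ y' γ) * h₁
  rw [h_conj, h_conj, h_conj, inv_mul_eq_div, inv_mul_eq_div, inv_mul_eq_div, div_mul_div_comm,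
    div_eq_div_iff (h_ne _ _) (mul_ne_zero (h_ne _ _) (h_ne _ _)), key]
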